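/- Let s₁,…,s_m be subsets of the n sites, let H = Σᵢ₌₁^m lift(hᵢ,sᵢ) where each hᵢ is a Hermitian matrix indexed by (sᵢ → Fin 2), and let ψ be a unit vector that is the unique ground state of H with ground energy λ and spectral gap at least Δ > 0. Then the tuple ((ψψ†)_{s₁},…,(ψψ†)_{s_m}) is an exposed point of ℛ (over the real scalars): there is a continuous real-linear functional on the tuple space that attains its strict maximum over ℛ exactly at this tuple. -/

import Mathlib

open Matrix
open scoped ComplexOrder

/-- The type of configurations of `n` qubits. -/
abbrev QConf (n : ℕ) := Fin n → Fin 2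

/-- An `n`-qubit matrix. -/
abbrev QMatrix (n : ℕ) := Matrix (QConf n) (QConf n) ℂ

/-- Combine a configuration `f` on the sites in `s` with a configuration `h` on the
complementary sites into a configuration on all `n` sites. -/
def mergeConf {n : ℕ} (s : Finset (Fin n)) (f : ↥s → Fin 2) (h : ↥sᶜ → Fin 2) :
    QConf n :=
  fun i => if hi : i ∈ s then f ⟨i, hi⟩ else h ⟨i, Finset.mem_compl.mpr hi⟩

/-- The reduced density matrix of an `n`-qubit matrix `ρ` on the subset `s` of sites
(partial trace over the complement of `s`). -/
noncomputable def reduce {n : ℕ} (ρ : QMatrix n) (s : Finset (Fin n)) :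
    Matrix (↥s → Fin 2) (↥s → Fin 2) ℂ :=
  fun f g => ∑ h : ↥sᶜ → Fin 2, ρ (mergeConf s f h) (mergeConf s g h)

/-- The lift of a matrix `h` on the sites in `s` to an `n`-qubit matrix:
`h` tensored with the identity on the complement of `s`. -/
def liftMat {n : ℕ} (s : Finset (Fin n)) (h : Matrix (↥s → Fin 2) (↥s → Fin 2) ℂ) :
    QMatrix n :=
  fun F G =>
    if ∀ i : ↥sᶜ, F i = G i then h (fun i : ↥s => F i) (fun i : ↥s => G i) else 0

/-- `ρ` is a density matrix: positive semidefinite with trace 1. -/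
def IsDensityMatrix {d : Type*} [Fintype d] (ρ : Matrix d d ℂ) : Prop :=
  ρ.PosSemidef ∧ ρ.trace = 1

/-- The convex set `ℛ` of tuples of reduced density matrices on the subsets
`s 0, …, s (m-1)`, as `ρ` ranges over all `n`-qubit density matrices. -/
noncomputable def RSet (n m : ℕ) (s : Fin m → Finset (Fin n)) :
    Set (∀ i : Fin m, Matrix (↥(s i) → Fin 2) (↥(s i) → Fin 2) ℂ) :=
  {t | ∃ ρ : QMatrix n, IsDensityMatrix ρ ∧ ∀ i, reduce ρ (s i) = t i}

/-- Configurations of all sites correspond to pairs of configurations on `s` and on its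
complement, via `mergeConf`. -/
def mergeConfEquiv {n : ℕ} (s : Finset (Fin n)) :
    (↥s → Fin 2) × (↥sᶜ → Fin 2) ≃ QConf n where
  toFun p := mergeConf s p.1 p.2
  invFun F := (fun i => F i, fun i => F i)
  left_inv p := by
    ext i
    · simp [mergeConf]
    · have := Finset.mem_compl.mp i.2
      simp [mergeConf, this]
  right_inv F := by
    ext i
    by_cases hi : i ∈ s <;> simp [mergeConf, hi]

theorem liftMat_mergeConf {n : ℕ} (s : Finset (Fin n))
    (h : Matrix (↥s → Fin 2) (↥s → Fin 2) ℂ) (f g : ↥s → Fin 2) (k l : ↥sᶜ → Fin 2) :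
    liftMat s h (mergeConf s f k) (mergeConf s g l) = if k = l then h f g else 0 := by
  have hs (f : ↥s → Fin 2) (k : ↥sᶜ → Fin 2) : (fun i : ↥s => mergeConf s f k i) = f :=
    congrArg Prod.fst ((mergeConfEquiv s).left_inv (f, k))
  have hc (f : ↥s → Fin 2) (k : ↥sᶜ → Fin 2) : (fun i : ↥sᶜ => mergeConf s f k i) = k :=
    congrArg Prod.snd ((mergeConfEquiv s).left_inv (f, k))
  have hiff : (∀ i : ↥sᶜ, mergeConf s f k i = mergeConf s g l i) ↔ k = l := by
    rw [← funext_iff, hc, hc]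
  simp only [liftMat, hs, hiff]

/-- The partial trace is dual to the lift. -/
theorem trace_liftMat_mul {n : ℕ} (s : Finset (Fin n))
    (h : Matrix (↥s → Fin 2) (↥s → Fin 2) ℂ) (ρ : QMatrix n) :
    (liftMat s h * ρ).trace = (h * reduce ρ s).trace := by
  simp only [trace, diag_apply, mul_apply, reduce]
  rw [← (mergeConfEquiv s).sum_comp, Fintype.sum_prod_type]
  refine Finset.sum_congr rfl fun f _ => ?_
  simp only [Finset.mul_sum]
  refine Eq.trans ?_ Finset.sum_comm
  refine Finset.sum_congr rfl fun k _ => ?_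
  rw [← (mergeConfEquiv s).sum_comp, Fintype.sum_prod_type]
  refine Finset.sum_congr rfl fun g _ => ?_
  simp [mergeConfEquiv, liftMat_mergeConf]

theorem liftMat_isHermitian {n : ℕ} (s : Finset (Fin n))
    {h : Matrix (↥s → Fin 2) (↥s → Fin 2) ℂ} (hh : h.IsHermitian) :
    (liftMat s h).IsHermitian := by
  ext F G
  simp only [conjTranspose_apply, liftMat, apply_ite star, star_zero, hh.apply, eq_comm]

open scoped MatrixOrder in
theorem Matrix.PosSemidef.exists_eq_conjTranspose_mul_self {d : Type*} [Fintype d] [DecidableEq d]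
    {A : Matrix d d ℂ} (hA : A.PosSemidef) : ∃ B : Matrix d d ℂ, A = Bᴴ * B :=
  CStarAlgebra.nonneg_iff_eq_star_mul_self.mp hA.nonneg

theorem trace_mul_nonneg_of_posSemidef {d : Type*} [Fintype d] {A B : Matrix d d ℂ}
    (hA : A.PosSemidef) (hB : B.PosSemidef) : 0 ≤ (A * B).trace := by
  classical
  obtain ⟨C, rfl⟩ := hB.exists_eq_conjTranspose_mul_self
  rw [← Matrix.mul_assoc, trace_mul_comm, ← Matrix.mul_assoc]
  exact (hA.mul_mul_conjTranspose_same C).trace_nonneg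

theorem Matrix.IsHermitian.posSemidef_mul_mul_of_re_nonneg {d : Type*} [Fintype d]
    {N Q : Matrix d d ℂ} (hN : N.IsHermitian) (hQ : Qᴴ = Q)
    (h : ∀ v : d → ℂ, 0 ≤ (star (Q *ᵥ v) ⬝ᵥ (N *ᵥ (Q *ᵥ v))).re) : (Q * N * Q).PosSemidef := by
  have hherm : (Q * N * Q).IsHermitian := by
    have := isHermitian_mul_mul_conjTranspose Q hN
    rwa [hQ] at this
  refine .of_dotProduct_mulVec_nonneg hherm fun v => ?_
  have heq : star v ⬝ᵥ ((Q * N * Q) *ᵥ v) = star (Q *ᵥ v) ⬝ᵥ (N *ᵥ (Q *ᵥ v)) := by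
    rw [star_mulVec, hQ, ← dotProduct_mulVec, mulVec_mulVec, mulVec_mulVec, Matrix.mul_assoc]
  have him : (star v ⬝ᵥ ((Q * N * Q) *ᵥ v)).im = 0 := hherm.im_star_dotProduct_mulVec_self v
  exact Complex.nonneg_iff.mpr ⟨heq ▸ h v, him.symm⟩

section GroundState

variable {d : Type*} [Fintype d]

theorem vecMulVec_star_mul_self {ψ : d → ℂ} (hψ : star ψ ⬝ᵥ ψ = 1) :
    vecMulVec ψ (star ψ) * vecMulVec ψ (star ψ) = vecMulVec ψ (star ψ) := by
  simp [vecMulVec_mul_vecMulVec, hψ]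

theorem isDensityMatrix_vecMulVec {ψ : d → ℂ} (hψ : star ψ ⬝ᵥ ψ = 1) :
    IsDensityMatrix (vecMulVec ψ (star ψ)) :=
  ⟨posSemidef_vecMulVec_self_star ψ, by rw [trace_vecMulVec, dotProduct_comm, hψ]⟩

/-- A density matrix annihilated by the compression to the orthogonal complement of `ψ` is the
projection onto `ψ`. -/
theorem IsDensityMatrix.eq_vecMulVec [DecidableEq d] {ρ : Matrix d d ℂ} (hρ : IsDensityMatrix ρ)
    {ψ : d → ℂ} (hψ : star ψ ⬝ᵥ ψ = 1)
    (h : ((1 - vecMulVec ψ (star ψ)) * ρ * (1 - vecMulVec ψ (star ψ))ᴴ).trace = 0) :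
    ρ = vecMulVec ψ (star ψ) := by
  obtain ⟨hpos, htr⟩ := hρ
  obtain ⟨B, rfl⟩ := hpos.exists_eq_conjTranspose_mul_self
  have hQ : (1 - vecMulVec ψ (star ψ)) * Bᴴ = 0 := by
    rw [← trace_mul_conjTranspose_self_eq_zero_iff, ← h]
    simp only [conjTranspose_mul, conjTranspose_conjTranspose, Matrix.mul_assoc]
  have hB : Bᴴ = vecMulVec ψ (star ψ ᵥ* Bᴴ) := by
    rwa [Matrix.sub_mul, Matrix.one_mul, sub_eq_zero, vecMulVec_mul] at hQ
  set u := star ψ ᵥ* Bᴴ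
  have hB' : B = vecMulVec (star u) (star ψ) := by
    rw [← conjTranspose_conjTranspose B, hB, conjTranspose_vecMulVec]
  have hprod : Bᴴ * B = (u ⬝ᵥ star u) • vecMulVec ψ (star ψ) := by
    rw [hB, hB', vecMulVec_mul_vecMulVec, vecMulVec_smul]
  rw [hprod, trace_smul, (isDensityMatrix_vecMulVec hψ).2, smul_eq_mul, mul_one] at htr
  rw [hprod, htr, one_smul]

/-- The energy of a state exceeds the ground energy by at least the gap times the weight of the
state outside of the ground space. -/
theorem gap_mul_trace_le [DecidableEq d] {H : Matrix d d ℂ} (hH : H.IsHermitian) {ψ : d → ℂ}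
    (hψ : star ψ ⬝ᵥ ψ = 1) {lam Δ : ℝ} (hground : H *ᵥ ψ = (lam : ℂ) • ψ)
    (hgap : ∀ v : d → ℂ, star ψ ⬝ᵥ v = 0 →
      (lam + Δ) * (star v ⬝ᵥ v).re ≤ (star v ⬝ᵥ (H *ᵥ v)).re)
    {ρ : Matrix d d ℂ} (hρ : IsDensityMatrix ρ) :
    lam + Δ * ((1 - vecMulVec ψ (star ψ)) * ρ * (1 - vecMulVec ψ (star ψ))ᴴ).trace.re ≤
      (H * ρ).trace.re := by
  have hPP := vecMulVec_star_mul_self hψ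
  have hPH : (vecMulVec ψ (star ψ))ᴴ = _ := (posSemidef_vecMulVec_self_star ψ).isHermitian
  generalize hP : vecMulVec ψ (star ψ) = P at hPP hPH ⊢
  have hHP : H * P = (lam : ℂ) • P := by rw [← hP, mul_vecMulVec, hground, smul_vecMulVec]
  have hPHc : P * H = (lam : ℂ) • P := by
    have := congrArg conjTranspose hHP
    rwa [conjTranspose_mul, hPH, hH.eq, conjTranspose_smul, hPH, Complex.star_def,
      Complex.conj_ofReal] at this
  have hQH : (1 - P)ᴴ = 1 - P := by rw [conjTranspose_sub, conjTranspose_one, hPH]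
  have hN : (H - ((lam + Δ : ℝ) : ℂ) • (1 : Matrix d d ℂ)).IsHermitian := by
    refine hH.sub ?_
    rw [IsHermitian, conjTranspose_smul, conjTranspose_one, Complex.star_def, Complex.conj_ofReal]
  have hM : (H - (lam : ℂ) • (1 : Matrix d d ℂ) - (Δ : ℂ) • (1 - P)).PosSemidef := by
    have hconj : H - (lam : ℂ) • (1 : Matrix d d ℂ) - (Δ : ℂ) • (1 - P) =
        (1 - P) * (H - ((lam + Δ : ℝ) : ℂ) • (1 : Matrix d d ℂ)) * (1 - P) := by
      simp only [Matrix.mul_sub, Matrix.sub_mul, Matrix.mul_one, Matrix.one_mul, hHP, hPHc, hPP,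
        Matrix.mul_smul, Matrix.smul_mul, Complex.ofReal_add, add_smul, Matrix.mul_add,
        Matrix.add_mul, smul_sub]
      abel
    rw [hconj]
    refine hN.posSemidef_mul_mul_of_re_nonneg hQH fun v => ?_
    have hort : star ψ ⬝ᵥ ((1 - P) *ᵥ v) = 0 := by
      rw [dotProduct_mulVec, vecMul_sub, vecMul_one, ← hP, vecMul_vecMulVec, hψ, one_smul,
        sub_self, zero_dotProduct]
    generalize (1 - P) *ᵥ v = w at hort ⊢
    rw [sub_mulVec, smul_mulVec, one_mulVec, dotProduct_sub, dotProduct_smul, smul_eq_mul,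
      Complex.sub_re, Complex.re_ofReal_mul]
    exact sub_nonneg.mpr (hgap _ hort)
  have htr := (Complex.nonneg_iff.mp (trace_mul_nonneg_of_posSemidef hM hρ.1)).1
  have hQQ : (1 - P) * (1 - P) = 1 - P := by
    simp [Matrix.mul_sub, Matrix.sub_mul, hPP]
  rw [hQH, Matrix.mul_assoc, trace_mul_comm, Matrix.mul_assoc, hQQ, trace_mul_comm]
  simp only [Matrix.sub_mul _ _ ρ, Matrix.smul_mul, Matrix.one_mul, trace_sub, trace_smul, hρ.2,
    smul_eq_mul, mul_one, Complex.sub_re, Complex.re_ofReal_mul, Complex.ofReal_re] at htr ⊢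
  linarith

end GroundState

/-- The energy of a tuple of reduced density matrices, as a real-linear functional. -/
noncomputable def energyFunctional {m : ℕ} {ι : Fin m → Type*} [∀ i, Fintype (ι i)]
    (h : ∀ i, Matrix (ι i) (ι i) ℂ) : (∀ i, Matrix (ι i) (ι i) ℂ) →L[ℝ] ℝ where
  toFun t := ∑ i, (h i * t i).trace.re
  map_add' t u := by simp [Matrix.mul_add, Finset.sum_add_distrib]
  map_smul' c t := by simp [Finset.mul_sum]
  cont := by fun_prop

theorem energyFunctional_reduce {n m : ℕ} (s : Fin m → Finset (Fin n))
    (h : ∀ i, Matrix (↥(s i) → Fin 2) (↥(s i) → Fin 2) ℂ) (ρ : QMatrix n) :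
    energyFunctional h (fun i => reduce ρ (s i)) =
      ((∑ i, liftMat (s i) (h i)) * ρ).trace.re := by
  simp [energyFunctional, Matrix.sum_mul, trace_sum, trace_liftMat_mul]

/-- If `ψ` is the unique ground state of the local Hamiltonian
`H = Σᵢ lift(hᵢ,sᵢ)` with Hermitian terms, ground energy `lam` and spectral gap at
least `Δ > 0`, then the tuple of reduced density matrices of `ψψ†` is an exposed point
of `ℛ` (over the real scalars): some continuous real-linear functional attains its
strict maximum over `ℛ` exactly at this tuple. -/
theorem exposedPoint_of_unique_ground_state
    (n m : ℕ) (s : Fin m → Finset (Fin n))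
    (hmat : ∀ i, Matrix (↥(s i) → Fin 2) (↥(s i) → Fin 2) ℂ)
    (hHerm : ∀ i, (hmat i).IsHermitian)
    (ψ : QConf n → ℂ) (hψ : star ψ ⬝ᵥ ψ = 1)
    (lam Δ : ℝ) (hΔ : 0 < Δ)
    (hground : (∑ i, liftMat (s i) (hmat i)) *ᵥ ψ = (lam : ℂ) • ψ)
    (hgap : ∀ v : QConf n → ℂ, star ψ ⬝ᵥ v = 0 →
      (lam + Δ) * (star v ⬝ᵥ v).re ≤ (star v ⬝ᵥ ((∑ i, liftMat (s i) (hmat i)) *ᵥ v)).re) :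
    (fun i => reduce (vecMulVec ψ (star ψ)) (s i)) ∈
      Set.exposedPoints ℝ (RSet n m s) := by
  have hH : (∑ i, liftMat (s i) (hmat i)).IsHermitian := by
    rw [IsHermitian, conjTranspose_sum]
    exact Finset.sum_congr rfl fun i _ => liftMat_isHermitian (s i) (hHerm i)
  have hψE : ((∑ i, liftMat (s i) (hmat i)) * vecMulVec ψ (star ψ)).trace.re = lam := by
    rw [mul_vecMulVec, hground, smul_vecMulVec, trace_smul, (isDensityMatrix_vecMulVec hψ).2,
      smul_eq_mul, mul_one, Complex.ofReal_re]
  refine ⟨⟨_, isDensityMatrix_vecMulVec hψ, fun _ => rfl⟩, -energyFunctional hmat, ?_⟩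
  rintro t ⟨ρ, hρ, ht⟩
  obtain rfl : (fun i => reduce ρ (s i)) = t := funext ht
  have hbound := gap_mul_trace_le hH hψ hground hgap hρ
  have hnonneg := (Complex.nonneg_iff.mp
    (hρ.1.mul_mul_conjTranspose_same (1 - vecMulVec ψ (star ψ))).trace_nonneg)
  simp only [_root_.neg_apply, energyFunctional_reduce, hψE, neg_le_neg_iff]
  refine ⟨by nlinarith [mul_nonneg hΔ.le hnonneg.1], fun hle => ?_⟩
  have hzero : ((1 - vecMulVec ψ (star ψ)) * ρ * (1 - vecMulVec ψ (star ψ))ᴴ).trace = 0 :=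
    Complex.ext (le_antisymm (by by_contra! hpos; nlinarith [mul_pos hΔ hpos]) hnonneg.1)
      hnonneg.2.symm
  rw [hρ.eq_vecMulVec hψ hzero]
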